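/- For every tree T_n on n vertices and every odd m ≥ 3 with n ≥ 50m, the Ramsey number R(T_n, C_m) equals 2n - 1. That is, every graph G on 2n - 1 vertices contains a cycle of length m or its complement contains T_n, and the bound 2n - 1 is optimal. -/

import Mathlib

namespace SimpleGraph

variable {α V : Type*}

/-- Every nonempty finite vertex set of a tree has a vertex with at most one neighbour in it. -/
lemma IsTree.exists_mem_forall_adj_eq {T : SimpleGraph α} (hT : T.IsTree) {S : Finset α}
    (hS : S.Nonempty) : ∃ v ∈ S, ∃ u, ∀ w ∈ S, T.Adj v w → w = u := by
  classical
  obtain ⟨r, hr⟩ := hS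
  obtain ⟨v, hv, hmax⟩ := S.exists_max_image (fun v => T.dist r v) ⟨r, hr⟩
  obtain ⟨p, hp, -⟩ := hT.connected.exists_path_of_dist r v
  refine ⟨v, hv, p.penultimate, fun w hw hvw => ?_⟩
  obtain ⟨q, hq, hql⟩ := hT.connected.exists_path_of_dist r w
  refine hT.isAcyclic.eq_penultimate_of_adj_end hp hvw
    (hT.isAcyclic.mem_support_of_ne_mem_support_of_adj_of_isPath hp hq hvw fun hmem => ?_)
  have h1 := hmax w hw
  have h2 := hT.dist_eq_dist_add_one_of_adj r hvw
  have h3 := (dist_le (q.takeUntil v hmem)).trans (q.length_takeUntil_le_length hmem)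
  omega

/-- Greedy embedding of a tree: the vertices of an independent set `I` are placed in `Q` and all
other vertices in `P`, provided that the relevant degrees are large enough. -/
lemma IsTree.exists_partial_embedding [DecidableEq α] [DecidableEq V] [Nonempty V]
    {T : SimpleGraph α} (hT : T.IsTree) (F : SimpleGraph V) [DecidableRel F.Adj] {I : Finset α}
    (hI : ∀ x ∈ I, ∀ y ∈ I, ¬ T.Adj x y) {P Q : Finset V} (hd : Disjoint P Q) {a b : ℕ}
    (hP : a ≤ P.card) (hQ : b ≤ Q.card)
    (hPP : ∀ p ∈ P, a ≤ (P.filter (F.Adj p)).card + 1)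
    (hPQ : ∀ p ∈ P, b ≤ (Q.filter (F.Adj p)).card)
    (hQP : ∀ q ∈ Q, a ≤ (P.filter (F.Adj q)).card) (S : Finset α)
    (ha : (S \ I).card ≤ a) (hb : (S ∩ I).card ≤ b) :
    ∃ f : α → V, Set.InjOn f S ∧ (∀ x ∈ S, x ∈ I → f x ∈ Q) ∧ (∀ x ∈ S, x ∉ I → f x ∈ P) ∧
      ∀ x ∈ S, ∀ y ∈ S, T.Adj x y → F.Adj (f x) (f y) := by
  induction S using Finset.strongInduction with
  | H S ih =>
  rcases S.eq_empty_or_nonempty with rfl | hS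
  · exact ⟨fun _ => Classical.arbitrary V, by simp⟩
  obtain ⟨v, hv, u, hu⟩ := hT.exists_mem_forall_adj_eq hS
  have hsub1 : (S.erase v \ I).card ≤ (S \ I).card :=
    Finset.card_le_card (Finset.sdiff_subset_sdiff (S.erase_subset v) subset_rfl)
  have hsub2 : (S.erase v ∩ I).card ≤ (S ∩ I).card :=
    Finset.card_le_card (Finset.inter_subset_inter (S.erase_subset v) subset_rfl)
  obtain ⟨f, hinj, hfI, hfP, hadj⟩ := ih (S.erase v) (Finset.erase_ssubset hv)
    (hsub1.trans ha) (hsub2.trans hb)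
  suffices ∃ z, z ∉ (S.erase v).image f ∧ (v ∈ I → z ∈ Q) ∧ (v ∉ I → z ∈ P) ∧
      (u ∈ S → T.Adj v u → F.Adj (f u) z) by
    obtain ⟨z, hz, hzQ, hzP, hzu⟩ := this
    have hne : ∀ x ∈ S, x ≠ v → f x ≠ z := fun x hx hxv h =>
      hz (Finset.mem_image.2 ⟨x, Finset.mem_erase.2 ⟨hxv, hx⟩, h⟩)
    refine ⟨Function.update f v z, ?_, ?_, ?_, ?_⟩
    · intro x hx y hy hxy
      by_cases hxv : x = v <;> by_cases hyv : y = v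
      · rw [hxv, hyv]
      · subst hxv
        simp only [Function.update_self, Function.update_of_ne hyv] at hxy
        exact absurd hxy.symm (hne y hy hyv)
      · subst hyv
        simp only [Function.update_self, Function.update_of_ne hxv] at hxy
        exact absurd hxy (hne x hx hxv)
      · simp only [Function.update_of_ne hyv, Function.update_of_ne hxv] at hxy
        exact hinj (by simpa [hxv] using hx) (by simpa [hyv] using hy) hxy
    · intro x hx hxI
      by_cases hxv : x = v
      · subst hxv; simpa using hzQ hxI
      · simpa [hxv] using hfI x (Finset.mem_erase.2 ⟨hxv, hx⟩) hxI
    · intro x hx hxI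
      by_cases hxv : x = v
      · subst hxv; simpa using hzP hxI
      · simpa [hxv] using hfP x (Finset.mem_erase.2 ⟨hxv, hx⟩) hxI
    · intro x hx y hy hxy
      by_cases hxv : x = v <;> by_cases hyv : y = v
      · subst hxv; subst hyv; exact absurd hxy (T.irrefl)
      · subst hxv
        obtain rfl := hu y hy hxy
        simpa [hyv] using (hzu hy hxy).symm
      · subst hyv
        obtain rfl := hu x hx hxy.symm
        simpa [hxv] using hzu hx hxy.symm
      · simpa [hxv, hyv] using hadj x (Finset.mem_erase.2 ⟨hxv, hx⟩) y
          (Finset.mem_erase.2 ⟨hyv, hy⟩) hxy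
  have key : ∀ D R : Finset V, D ⊆ R → ∀ U : Finset α,
      (∀ x ∈ S.erase v, f x ∈ R → x ∈ U) → U.card < D.card →
      ∃ z ∈ D, z ∉ (S.erase v).image f := by
    intro D R hDR U hU hlt
    by_contra! hcon
    have : D ⊆ U.image f := by
      intro z hz
      obtain ⟨x, hx, rfl⟩ := Finset.mem_image.1 (hcon z hz)
      exact Finset.mem_image_of_mem _ (hU x hx (hDR hz))
    have := (Finset.card_le_card this).trans Finset.card_image_le
    omega
  have hQU : ∀ x ∈ S.erase v, f x ∈ Q → x ∈ S.erase v ∩ I := fun x hx hxQ => by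
    by_contra h
    exact Finset.disjoint_left.1 hd (hfP x hx fun hI => h (Finset.mem_inter.2 ⟨hx, hI⟩)) hxQ
  have hPU : ∀ x ∈ S.erase v, f x ∈ P → x ∈ S.erase v \ I := fun x hx hxP =>
    Finset.mem_sdiff.2 ⟨hx, fun hxI => Finset.disjoint_left.1 hd hxP (hfI x hx hxI)⟩
  by_cases hvI : v ∈ I
  · have hlt : (S.erase v ∩ I).card < b := by
      refine lt_of_lt_of_le (Finset.card_lt_card ?_) hb
      refine Finset.ssubset_iff_subset_ne.2
        ⟨Finset.inter_subset_inter (S.erase_subset v) subset_rfl, fun h => ?_⟩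
      have : v ∈ S.erase v ∩ I := h ▸ Finset.mem_inter.2 ⟨hv, hvI⟩
      simp at this
    by_cases huv : u ∈ S ∧ T.Adj v u
    · have huI : u ∉ I := fun h => hI v hvI u h huv.2
      have hu' : u ∈ S.erase v := Finset.mem_erase.2 ⟨huv.2.ne', huv.1⟩
      obtain ⟨z, hz, hz'⟩ := key (Q.filter (F.Adj (f u))) Q (Finset.filter_subset _ _) _ hQU
        (hlt.trans_le (hPQ _ (hfP u hu' huI)))
      exact ⟨z, hz', fun _ => (Finset.mem_filter.1 hz).1, fun h => absurd hvI h,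
        fun _ _ => (Finset.mem_filter.1 hz).2⟩
    · obtain ⟨z, hz, hz'⟩ := key Q Q subset_rfl _ hQU (hlt.trans_le hQ)
      exact ⟨z, hz', fun _ => hz, fun h => absurd hvI h, fun h1 h2 => absurd ⟨h1, h2⟩ huv⟩
  · have hlt : (S.erase v \ I).card < a := by
      refine lt_of_lt_of_le (Finset.card_lt_card ?_) ha
      refine Finset.ssubset_iff_subset_ne.2
        ⟨Finset.sdiff_subset_sdiff (S.erase_subset v) subset_rfl, fun h => ?_⟩
      have : v ∈ S.erase v \ I := h ▸ Finset.mem_sdiff.2 ⟨hv, hvI⟩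
      simp at this
    by_cases huv : u ∈ S ∧ T.Adj v u
    · have hu' : u ∈ S.erase v := Finset.mem_erase.2 ⟨huv.2.ne', huv.1⟩
      by_cases huI : u ∈ I
      · obtain ⟨z, hz, hz'⟩ := key (P.filter (F.Adj (f u))) P (Finset.filter_subset _ _) _ hPU
          (hlt.trans_le (hQP _ (hfI u hu' huI)))
        exact ⟨z, hz', fun h => absurd h hvI, fun _ => (Finset.mem_filter.1 hz).1,
          fun _ _ => (Finset.mem_filter.1 hz).2⟩
      · obtain ⟨z, hz, hz'⟩ := key (P.filter (F.Adj (f u))) (P.erase (f u))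
          (fun z hz => Finset.mem_erase.2
            ⟨(Finset.mem_filter.1 hz).2.ne', (Finset.mem_filter.1 hz).1⟩)
          ((S.erase v \ I).erase u)
          (fun x hx hxP => Finset.mem_erase.2 ⟨fun h => (Finset.mem_erase.1 hxP).1 (by rw [h]),
            hPU x hx (Finset.mem_erase.1 hxP).2⟩)
          (by
            have h1 := hPP _ (hfP u hu' huI)
            have h2 := Finset.card_erase_add_one (Finset.mem_sdiff.2 ⟨hu', huI⟩)
            omega)
        exact ⟨z, hz', fun h => absurd h hvI, fun _ => (Finset.mem_filter.1 hz).1,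
          fun _ _ => (Finset.mem_filter.1 hz).2⟩
    · obtain ⟨z, hz, hz'⟩ := key P P subset_rfl _ hPU (hlt.trans_le hP)
      exact ⟨z, hz', fun h => absurd h hvI, fun _ => hz, fun h1 h2 => absurd ⟨h1, h2⟩ huv⟩

lemma IsTree.exists_embedding_of_degrees [Fintype α] [DecidableEq α] [DecidableEq V]
    {T : SimpleGraph α} (hT : T.IsTree) (F : SimpleGraph V) [DecidableRel F.Adj] {I : Finset α}
    (hI : ∀ x ∈ I, ∀ y ∈ I, ¬ T.Adj x y) {P Q : Finset V} (hd : Disjoint P Q)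
    {a b : ℕ} (hab : Fintype.card α ≤ a + b) (hIb : I.card = b)
    (hP : a ≤ P.card) (hQ : b ≤ Q.card)
    (hPP : ∀ p ∈ P, a ≤ (P.filter (F.Adj p)).card + 1)
    (hPQ : ∀ p ∈ P, b ≤ (Q.filter (F.Adj p)).card)
    (hQP : ∀ q ∈ Q, a ≤ (P.filter (F.Adj q)).card) :
    ∃ f : T →g F, Function.Injective f := by
  have hα : 0 < Fintype.card α := Fintype.card_pos_iff.2 hT.connected.nonempty
  have hV : Nonempty V := by
    rcases P.eq_empty_or_nonempty with rfl | ⟨x, -⟩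
    · rcases Q.eq_empty_or_nonempty with rfl | ⟨x, -⟩
      · simp at hP hQ; omega
      · exact ⟨x⟩
    · exact ⟨x⟩
  obtain ⟨f, hf, -, -, hadj⟩ := hT.exists_partial_embedding F hI hd hP hQ hPP hPQ hQP Finset.univ
    (by
      have := Finset.card_sdiff_add_card_eq_card (Finset.subset_univ I)
      rw [Finset.card_univ] at this
      omega)
    (by simp [hIb])
  exact ⟨⟨f, fun h => hadj _ (Finset.mem_univ _) _ (Finset.mem_univ _) h⟩,
    fun x y h => hf (by simp) (by simp) h⟩

/-- The smaller colour class of a tree. -/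
lemma IsTree.exists_small_class [Fintype α] {T : SimpleGraph α} (hT : T.IsTree) :
    ∃ J : Finset α, 2 * J.card ≤ Fintype.card α ∧ ∀ u v, T.Adj u v → (u ∈ J ↔ v ∉ J) := by
  classical
  obtain ⟨c⟩ := hT.colorable_two
  set J := Finset.univ.filter fun v => c v = 0 with hJ
  have hcol : ∀ u v, T.Adj u v → (u ∈ J ↔ v ∉ J) := by
    intro u v h
    have := c.valid h
    simp only [hJ, Finset.mem_filter, Finset.mem_univ, true_and]
    omega
  have := Finset.card_add_card_compl J
  rcases le_total J.card Jᶜ.card with h | h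
  · exact ⟨J, by omega, hcol⟩
  · refine ⟨Jᶜ, by omega, fun u v huv => ?_⟩
    have := hcol u v huv
    simp only [Finset.mem_compl]
    tauto

lemma IsTree.exists_embedding_of_complete_pair [Fintype α] [DecidableEq V]
    {T : SimpleGraph α} (hT : T.IsTree) {F : SimpleGraph V} {X Y : Finset V}
    (hXY : ∀ x ∈ X, ∀ y ∈ Y, x ≠ y → F.Adj x y) (c : ℕ)
    (hU : Fintype.card α ≤ (X ∪ Y).card) (hX : Fintype.card α ≤ X.card + c)
    (hY : Fintype.card α ≤ Y.card + c) (hZ : c ≤ (X ∩ Y).card) :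
    ∃ f : T →g F, Function.Injective f := by
  classical
  obtain ⟨J, hJ, hcol⟩ := hT.exists_small_class
  have hJc := Finset.card_add_card_compl J
  suffices ∃ J' I' : Finset V, J'.card = J.card ∧ Jᶜ.card ≤ I'.card ∧ Disjoint J' I' ∧
      ∀ x ∈ J', ∀ y ∈ I', x ≠ y → F.Adj x y by
    obtain ⟨J', I', hJ', hI', hdis, hadj⟩ := this
    have e1 : Nonempty (J ↪ J') := Function.Embedding.nonempty_of_card_le (by simp [hJ'])
    have e2 : Nonempty ((Jᶜ : Finset α) ↪ I') :=
      Function.Embedding.nonempty_of_card_le (by simp only [Fintype.card_coe]; exact hI')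
    obtain ⟨e1⟩ := e1
    obtain ⟨e2⟩ := e2
    let f : α → V := fun v => if h : v ∈ J then e1 ⟨v, h⟩ else e2 ⟨v, Finset.mem_compl.2 h⟩
    have f1 : ∀ v (h : v ∈ J), f v = e1 ⟨v, h⟩ := fun v h => dif_pos h
    have f2 : ∀ v (h : v ∉ J), f v = e2 ⟨v, Finset.mem_compl.2 h⟩ := fun v h => dif_neg h
    have m1 : ∀ v, v ∈ J → f v ∈ J' := fun v h => by rw [f1 v h]; exact (e1 _).2
    have m2 : ∀ v, v ∉ J → f v ∈ I' := fun v h => by rw [f2 v h]; exact (e2 _).2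
    have hne : ∀ u v, u ∈ J → v ∉ J → f u ≠ f v := fun u v hu hv h =>
      Finset.disjoint_left.1 hdis (m1 u hu) (h ▸ m2 v hv)
    refine ⟨⟨f, fun {u v} huv => ?_⟩, fun u v huv => ?_⟩
    · by_cases hu : u ∈ J
      · have hv := (hcol u v huv).1 hu
        exact hadj _ (m1 u hu) _ (m2 v hv) (hne u v hu hv)
      · have hv : v ∈ J := by have := hcol u v huv; tauto
        exact (hadj _ (m1 v hv) _ (m2 u hu) (hne v u hv hu)).symm
    · change f u = f v at huv
      by_cases hu : u ∈ J <;> by_cases hv : v ∈ J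
      · rw [f1 u hu, f1 v hv] at huv
        simpa using e1.injective (Subtype.ext huv)
      · exact absurd huv (hne u v hu hv)
      · exact absurd huv.symm (hne v u hv hu)
      · rw [f2 u hu, f2 v hv] at huv
        simpa using e2.injective (Subtype.ext huv)
  have hUZ := Finset.card_union_add_card_inter X Y
  by_cases h : J.card ≤ (X ∩ Y).card
  · obtain ⟨J', hJ's, hJ'⟩ := Finset.exists_subset_card_eq h
    have hJU : J' ⊆ X ∪ Y := hJ's.trans (Finset.inter_subset_left.trans Finset.subset_union_left)
    refine ⟨J', (X ∪ Y) \ J', hJ', ?_, Finset.disjoint_sdiff, fun x hx y hy hxy => ?_⟩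
    · have := Finset.card_sdiff_add_card_eq_card hJU
      omega
    · have hx := Finset.mem_inter.1 (hJ's hx)
      rcases Finset.mem_union.1 (Finset.mem_sdiff.1 hy).1 with hy | hy
      · exact (hXY y hy x hx.2 hxy.symm).symm
      · exact hXY x hx.1 y hy hxy
  · have hadj : ∀ J' ⊆ Y, ∀ x ∈ J', ∀ y ∈ X \ J', x ≠ y → F.Adj x y :=
      fun J' hJ' x hx y hy hxy => (hXY y (Finset.mem_sdiff.1 hy).1 x (hJ' hx) hxy.symm).symm
    rcases le_total J.card (Y \ X).card with h' | h'
    · obtain ⟨J', hJ's, hJ'⟩ := Finset.exists_subset_card_eq h'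
      refine ⟨J', X \ J', hJ', ?_, Finset.disjoint_sdiff,
        hadj J' (hJ's.trans Finset.sdiff_subset)⟩
      have : Disjoint X J' := Finset.disjoint_of_subset_right hJ's Finset.disjoint_sdiff
      rw [Finset.sdiff_eq_self_of_disjoint this]
      omega
    · obtain ⟨J', hJ's, hJ'Y, hJ'⟩ := Finset.exists_subsuperset_card_eq
        (Finset.sdiff_subset : Y \ X ⊆ Y) h' (by omega)
      refine ⟨J', X \ J', hJ', ?_, Finset.disjoint_sdiff, hadj J' hJ'Y⟩
      have h1 : X ∪ Y ⊆ (X \ J') ∪ J' := by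
        intro z hz
        by_cases hzJ : z ∈ J'
        · exact Finset.mem_union_right _ hzJ
        · by_cases hzX : z ∈ X
          · exact Finset.mem_union_left _ (Finset.mem_sdiff.2 ⟨hzX, hzJ⟩)
          · have hzY := (Finset.mem_union.1 hz).resolve_left hzX
            exact Finset.mem_union_right _ (hJ's (Finset.mem_sdiff.2 ⟨hzY, hzX⟩))
      have h2 := (Finset.card_le_card h1).trans (Finset.card_union_le _ _)
      omega

/-- Every large vertex set contains a vertex of large degree when the complement is `T`-free. -/
lemma IsTree.exists_mem_card_le_degree [Fintype α] [Fintype V] [DecidableEq V]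
    {T : SimpleGraph α} (hT : T.IsTree) (G : SimpleGraph V) [DecidableRel G.Adj]
    (hfree : ¬ ∃ f : T →g Gᶜ, Function.Injective f) {S : Finset V}
    (hS : Fintype.card α ≤ S.card) : ∃ v ∈ S, S.card + 1 ≤ G.degree v + Fintype.card α := by
  classical
  by_contra! hcon
  refine hfree (hT.exists_embedding_of_degrees Gᶜ (I := ∅) (P := S) (Q := ∅)
    (a := Fintype.card α) (b := 0) (by simp) (by simp) (by simp) (by simp) hS (by simp)
    (fun p hp => ?_) (by simp) (by simp))
  have h1 : S ⊆ insert p (S.filter (Gᶜ.Adj p) ∪ G.neighborFinset p) := by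
    intro z hz
    by_cases hzp : z = p
    · simp [hzp]
    · by_cases hadj : G.Adj p z
      · simp [hadj]
      · simp [hz, hadj, Ne.symm hzp]
  have h2 := Finset.card_le_card h1
  have h3 := Finset.card_insert_le p (S.filter (Gᶜ.Adj p) ∪ G.neighborFinset p)
  have h4 := Finset.card_union_le (S.filter (Gᶜ.Adj p)) (G.neighborFinset p)
  have h5 := hcon p hp
  rw [card_neighborFinset_eq_degree] at h4
  omega

lemma IsTree.card_filter_degree_ge [Fintype α] [Fintype V] [DecidableEq V]
    {T : SimpleGraph α} (hT : T.IsTree) (G : SimpleGraph V) [DecidableRel G.Adj]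
    (hfree : ¬ ∃ f : T →g Gᶜ, Function.Injective f)
    (hV : Fintype.card V + 1 = 2 * Fintype.card α) {t : ℕ} (ht : t ≤ Fintype.card α) :
    t ≤ (Finset.univ.filter fun v => Fintype.card α + 1 ≤ G.degree v + t).card := by
  set H := Finset.univ.filter fun v => Fintype.card α + 1 ≤ G.degree v + t with hH
  by_contra! hlt
  have h1 := Finset.card_add_card_compl H
  obtain ⟨v, hv, hdeg⟩ := hT.exists_mem_card_le_degree G hfree (S := Hᶜ) (by omega)
  refine (Finset.mem_compl.1 hv) ?_
  simp only [hH, Finset.mem_filter, Finset.mem_univ, true_and]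
  omega

lemma Walk.IsPath.exists_isCycle {G : SimpleGraph V} {u v : V} {p : G.Walk u v} (hp : p.IsPath)
    (hl : 2 ≤ p.length) (h : G.Adj v u) :
    ∃ c : G.Walk v v, c.IsCycle ∧ c.length = p.length + 1 := by
  refine ⟨.cons h p, (Walk.cons_isCycle_iff p h).2 ⟨hp, fun hmem => ?_⟩, by simp⟩
  cases p with
  | nil => simp at hl
  | cons huw q =>
    rw [Walk.cons_isPath_iff] at hp
    rw [Walk.edges_cons, List.mem_cons] at hmem
    rcases hmem with hmem | hmem
    · rcases Sym2.eq_iff.1 hmem with ⟨h1, -⟩ | ⟨h1, -⟩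
      · exact h.ne h1
      · subst h1
        rw [Walk.isPath_iff_nil, ← Walk.length_eq_zero_iff] at hp
        simp [hp.1] at hl
    · exact hp.2 (q.snd_mem_support_of_mem_edges hmem)

lemma Walk.IsPath.exists_isCycle_of_adj {G : SimpleGraph V} {u v x y : V} {p : G.Walk u v}
    (hp : p.IsPath) (hx : x ∉ p.support) (hy : y ∉ p.support) (hxu : G.Adj x u) (hvy : G.Adj v y)
    (hxy : G.Adj x y) : ∃ c : G.Walk y y, c.IsCycle ∧ c.length = p.length + 3 := by
  have hq : (Walk.cons hxu (p.concat hvy)).IsPath := by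
    rw [Walk.cons_isPath_iff]
    refine ⟨hp.concat hy hvy, ?_⟩
    simp [Walk.support_concat, hx, hxy.ne]
  obtain ⟨c, hc, hl⟩ := hq.exists_isCycle (by simp) hxy.symm
  exact ⟨c, hc, by simpa using hl⟩

/-- Two distinct vertices with many common neighbours. -/
def ManyCommon [Fintype V] [DecidableEq V] (G : SimpleGraph V) [DecidableRel G.Adj] (t : ℕ)
    (i j : V) : Prop :=
  i ≠ j ∧ t ≤ (G.neighborFinset i ∩ G.neighborFinset j).card

lemma ManyCommon.symm [Fintype V] [DecidableEq V] {G : SimpleGraph V} [DecidableRel G.Adj] {t : ℕ}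
    {i j : V} (h : G.ManyCommon t i j) : G.ManyCommon t j i :=
  ⟨h.1.symm, by rw [Finset.inter_comm]; exact h.2⟩

lemma ManyCommon.exists_path [Fintype V] [DecidableEq V] {G : SimpleGraph V} [DecidableRel G.Adj]
    {t d : ℕ} (hdt : d ≤ t) {K : Finset V}
    (hK : ∀ i ∈ K, ∀ j ∈ K, ∃ L ⊆ K, d ≤ L.card ∧
      ∀ w ∈ L, G.ManyCommon t i w ∧ G.ManyCommon t w j)
    (r : ℕ) : ∀ i ∈ K, ∀ j ∈ K, G.ManyCommon t i j → ∀ X : Finset V, i ∉ X → j ∉ X →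
      X.card + 2 * r < d → ∃ p : G.Walk i j, p.IsPath ∧ p.length = 2 * (r + 1) ∧
        ∀ x ∈ X, x ∉ p.support := by
  have common : ∀ i j, G.ManyCommon t i j → ∀ X : Finset V, X.card < d →
      ∃ z, z ∉ X ∧ G.Adj i z ∧ G.Adj z j := by
    intro i j hij X hX
    obtain ⟨z, hz, hzX⟩ := Finset.exists_mem_notMem_of_card_lt_card
      (hX.trans_le (hdt.trans hij.2))
    rw [Finset.mem_inter, mem_neighborFinset, mem_neighborFinset] at hz
    exact ⟨z, hzX, hz.1, hz.2.symm⟩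
  induction r with
  | zero =>
    intro i _ j _ hij X hiX hjX hX
    obtain ⟨z, hzX, hiz, hzj⟩ := common i j hij X (by omega)
    refine ⟨.cons hiz (.cons hzj .nil), ?_, by simp, ?_⟩
    · simp [Walk.cons_isPath_iff, hiz.ne, hzj.ne, hij.1]
    · intro x hx
      simp only [Walk.support_cons, Walk.support_nil, List.mem_cons, List.not_mem_nil, or_false]
      rintro (rfl | rfl | rfl) <;> contradiction
  | succ r ih =>
    intro i hi j hj hij X hiX hjX hX
    obtain ⟨L, hLK, hLd, hL⟩ := hK i hi j hj
    obtain ⟨w, hwL, hwX⟩ := Finset.exists_mem_notMem_of_card_lt_card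
      (show X.card < L.card by omega)
    obtain ⟨hiw, hwj⟩ := hL w hwL
    obtain ⟨z, hz, hiz, hzw⟩ := common i w hiw (insert j X)
      (by have := Finset.card_insert_le j X; omega)
    rw [Finset.mem_insert, not_or] at hz
    obtain ⟨q, hq, hql, hqX⟩ := ih w (hLK hwL) j hj hwj (insert i (insert z X))
      (by simp [hiw.1.symm, hzw.ne', hwX]) (by simp [hij.1.symm, Ne.symm hz.1, hjX])
      (by
        have := Finset.card_insert_le i (insert z X)
        have := Finset.card_insert_le z X
        omega)
    have hiq := hqX i (by simp)
    have hzq := hqX z (by simp)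
    refine ⟨.cons hiz (.cons hzw q), ?_, by simp [hql]; omega, ?_⟩
    · simp [Walk.cons_isPath_iff, hq, hzq, hiq, hiz.ne]
    · intro x hx
      simp only [Walk.support_cons, List.mem_cons]
      rintro (rfl | rfl | h)
      · contradiction
      · exact hz.2 hx
      · exact hqX x (by simp [hx]) h

/-- Among any three vertices of large degree, two have many common neighbours. -/
lemma manyCommon_of_degree [Fintype V] [DecidableEq V] {G : SimpleGraph V} [DecidableRel G.Adj]
    {t n : ℕ} (hV : Fintype.card V + 1 = 2 * n) (ht : 6 * t ≤ n) {i j l : V}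
    (hij : i ≠ j) (hil : i ≠ l) (hjl : j ≠ l) (hi : n + 1 ≤ G.degree i + t)
    (hj : n + 1 ≤ G.degree j + t) (hl : n + 1 ≤ G.degree l + t) (h1 : ¬ G.ManyCommon t i j)
    (h2 : ¬ G.ManyCommon t i l) : G.ManyCommon t j l := by
  by_contra h3
  simp only [ManyCommon, not_and, not_le] at h1 h2 h3
  specialize h1 hij
  specialize h2 hil
  specialize h3 hjl
  rw [← card_neighborFinset_eq_degree] at hi hj hl
  set A := G.neighborFinset i
  set B := G.neighborFinset j
  set C := G.neighborFinset l
  have e1 := Finset.card_union_add_card_inter A B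
  have e2 := Finset.card_union_add_card_inter (A ∪ B) C
  have e3 : ((A ∪ B) ∩ C).card ≤ (A ∩ C).card + (B ∩ C).card := by
    rw [Finset.union_inter_distrib_right]
    exact Finset.card_union_le _ _
  have e4 := Finset.card_le_univ (A ∪ B ∪ C)
  omega

/-- If among any three vertices of `H` two are related, then some subset of `H` is well connected
by the relation. -/
lemma exists_subset_forall_common {R : V → V → Prop} (hsymm : ∀ i j, R i j → R j i)
    {H : Finset V} {m : ℕ} (hm : 5 ≤ m) (hH : 5 * m ≤ H.card)
    (hR : ∀ i ∈ H, ∀ j ∈ H, ∀ l ∈ H, i ≠ j → i ≠ l → j ≠ l → ¬ R i j → ¬ R i l → R j l) :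
    ∃ K ⊆ H, K.Nonempty ∧ ∀ i ∈ K, ∀ j ∈ K, ∃ L ⊆ K, m + 2 ≤ L.card ∧ ∀ w ∈ L, R i w ∧ R w j := by
  classical
  let M : V → Finset V := fun i => H.filter fun w => w ≠ i ∧ ¬ R i w
  by_cases h : ∃ i ∈ H, m + 4 ≤ (M i).card
  · obtain ⟨i, hi, hM⟩ := h
    have hclique : ∀ j ∈ M i, ∀ l ∈ M i, j ≠ l → R j l := by
      intro j hj l hl hjl
      simp only [M, Finset.mem_filter] at hj hl
      exact hR i hi j hj.1 l hl.1 hj.2.1.symm hl.2.1.symm hjl hj.2.2 hl.2.2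
    refine ⟨M i, Finset.filter_subset _ _, Finset.card_pos.1 (by omega), fun j hj l hl =>
      ⟨((M i).erase j).erase l, (Finset.erase_subset _ _).trans (Finset.erase_subset _ _), ?_,
        fun w hw => ?_⟩⟩
    · have h1 := Finset.pred_card_le_card_erase (s := M i) (a := j)
      have h2 := Finset.pred_card_le_card_erase (s := (M i).erase j) (a := l)
      omega
    · simp only [Finset.mem_erase] at hw
      exact ⟨hclique j hj w hw.2.2 hw.2.1.symm, hclique w hw.2.2 l hl hw.1⟩
  · push Not at h
    refine ⟨H, subset_rfl, Finset.card_pos.1 (by omega), fun i hi j hj =>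
      ⟨H \ (insert i (M i) ∪ insert j (M j)), Finset.sdiff_subset, ?_, fun w hw => ?_⟩⟩
    · have h1 := Finset.le_card_sdiff (insert i (M i) ∪ insert j (M j)) H
      have h2 := Finset.card_union_le (insert i (M i)) (insert j (M j))
      have h3 := Finset.card_insert_le i (M i)
      have h4 := Finset.card_insert_le j (M j)
      have h5 := h i hi
      have h6 := h j hj
      omega
    · simp only [M, Finset.mem_sdiff, Finset.mem_union, Finset.mem_insert, Finset.mem_filter,
        not_or, not_and, not_not] at hw
      exact ⟨hw.2.1.2 hw.1 hw.2.1.1, hsymm _ _ (hw.2.2.2 hw.1 hw.2.2.1)⟩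

lemma compl_adj_of_forall_not_adj {G : SimpleGraph V} {X Y : Finset V}
    (h : ∀ x ∈ X, ∀ y ∈ Y, ¬ G.Adj x y) : ∀ x ∈ X, ∀ y ∈ Y, x ≠ y → Gᶜ.Adj x y :=
  fun x hx y hy hxy => (compl_adj G x y).2 ⟨hxy, h x hx y hy⟩

/-- If `A` is a large independent set of `G` and many vertices outside of `A` have at most one
neighbour in `A`, then the complement of `G` contains the tree `T`. -/
lemma IsTree.exists_embedding_compl_of_few_neighbors [Fintype α] [DecidableEq V]
    {T : SimpleGraph α} (hT : T.IsTree) (G : SimpleGraph V) [DecidableRel G.Adj] {t : ℕ}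
    {A C : Finset V} (ht : 4 * t ≤ Fintype.card α) (hAC : Disjoint A C)
    (hA : ∀ x ∈ A, ∀ y ∈ A, ¬ G.Adj x y)
    (hAcard : Fintype.card α + 2 ≤ A.card + 2 * t) (hCcard : 4 * t ≤ C.card)
    (hC : ∀ c ∈ C, (A.filter (G.Adj c)).card ≤ 1) :
    ∃ f : T →g Gᶜ, Function.Injective f := by
  classical
  set P := A.filter fun a => 2 * t ≤ (C.filter (Gᶜ.Adj a)).card with hP
  have hsplit : ∀ a ∈ A, C.card ≤ (C.filter (Gᶜ.Adj a)).card + (C.filter (G.Adj a)).card := by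
    intro a ha
    refine (Finset.card_le_card fun c hc => ?_).trans (Finset.card_union_le _ _)
    have hac : a ≠ c := fun h => Finset.disjoint_left.1 hAC ha (h ▸ hc)
    by_cases h : G.Adj a c <;> simp [hc, h, hac]
  have hAP : (A \ P).card ≤ 1 := by
    refine Finset.card_le_one.2 fun a ha b hb => ?_
    by_contra hab
    simp only [hP, Finset.mem_sdiff, Finset.mem_filter, not_and, not_le] at ha hb
    have h1 := ha.2 ha.1
    have h2 := hb.2 hb.1
    have h3 := hsplit a ha.1
    have h4 := hsplit b hb.1
    have hdis : Disjoint (C.filter (G.Adj a)) (C.filter (G.Adj b)) := by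
      refine Finset.disjoint_left.2 fun c hca hcb => hab ?_
      rw [Finset.mem_filter] at hca hcb
      exact Finset.card_le_one.1 (hC c hca.1) a (by simp [ha.1, hca.2.symm]) b
        (by simp [hb.1, hcb.2.symm])
    have h5 : (C.filter (G.Adj a) ∪ C.filter (G.Adj b)).card ≤ C.card :=
      Finset.card_le_card (Finset.union_subset (Finset.filter_subset _ _)
        (Finset.filter_subset _ _))
    rw [Finset.card_union_of_disjoint hdis] at h5
    omega
  have hPA : P ⊆ A := Finset.filter_subset _ _
  have hPcard := Finset.card_sdiff_add_card_eq_card hPA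
  obtain ⟨J, hJ, hcol⟩ := hT.exists_small_class
  have hJc := Finset.card_add_card_compl J
  obtain ⟨I, hIJ, hI⟩ := Finset.exists_subset_card_eq (show 2 * t ≤ Jᶜ.card by omega)
  refine hT.exists_embedding_of_degrees Gᶜ (I := I) (P := P) (Q := C)
    (a := Fintype.card α - 2 * t) (b := 2 * t) (fun x hx y hy hxy => ?_)
    (Finset.disjoint_of_subset_left hPA hAC) (by omega) hI (by omega) (by omega)
    (fun p hp => ?_) (fun p hp => ?_) (fun c hc => ?_)
  · have := hcol x y hxy
    have h1 := Finset.mem_compl.1 (hIJ hx)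
    have h2 := Finset.mem_compl.1 (hIJ hy)
    tauto
  · have h1 : P.erase p ⊆ P.filter (Gᶜ.Adj p) := fun z hz => by
      rw [Finset.mem_erase] at hz
      simp [hz.2, hz.1.symm, hA p (hPA hp) z (hPA hz.2)]
    have h2 := Finset.card_le_card h1
    have h3 := Finset.card_erase_add_one hp
    omega
  · exact (Finset.mem_filter.1 hp).2
  · have h1 : P ⊆ P.filter (Gᶜ.Adj c) ∪ A.filter (G.Adj c) := fun z hz => by
      have hcz : c ≠ z := fun h => Finset.disjoint_left.1 hAC (hPA hz) (h ▸ hc)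
      by_cases h : G.Adj c z <;> simp [hz, hPA hz, h, hcz]
    have h2 := (Finset.card_le_card h1).trans (Finset.card_union_le _ _)
    have h3 := hC c hc
    omega

/-- Two vertices of large degree with many common neighbours that are joined by robustly many
paths of even length force an odd cycle in `G` or a copy of the tree in its complement. -/
lemma IsTree.exists_isCycle_of_pair [Fintype α] [Fintype V] [DecidableEq V]
    {T : SimpleGraph α} (hT : T.IsTree) (G : SimpleGraph V) [DecidableRel G.Adj]
    (hfree : ¬ ∃ f : T →g Gᶜ, Function.Injective f)
    (hV : Fintype.card V + 1 = 2 * Fintype.card α) {s t : ℕ} (ht : 10 * t ≤ Fintype.card α)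
    {i j : V} (hij : G.ManyCommon t i j)
    (hi : Fintype.card α + 1 ≤ G.degree i + t) (hj : Fintype.card α + 1 ≤ G.degree j + t)
    (hpath : ∀ (r : ℕ) (X : Finset V), i ∉ X → j ∉ X → X.card + 2 * r < 2 * s + 7 →
      ∃ p : G.Walk i j, p.IsPath ∧ p.length = 2 * (r + 1) ∧ ∀ x ∈ X, x ∉ p.support) :
    ∃ (u : V) (c : G.Walk u u), c.IsCycle ∧ c.length = 2 * s + 5 := by
  classical
  by_contra! hC
  replace hC : ∀ u, ¬ ∃ c : G.Walk u u, c.IsCycle ∧ c.length = 2 * s + 5 :=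
    fun u ⟨c, hc, hl⟩ => hC u c hc hl
  have hnij : ¬ G.Adj i j := fun h => by
    obtain ⟨p, hp, hl, -⟩ := hpath (s + 1) ∅ (by simp) (by simp)
      (by rw [Finset.card_empty]; omega)
    obtain ⟨c, hc, hcl⟩ := hp.exists_isCycle (by omega) h.symm
    exact hC _ ⟨c, hc, by omega⟩
  rw [← card_neighborFinset_eq_degree] at hi hj
  set X := G.neighborFinset i with hX
  set Y := G.neighborFinset j with hY
  have hXmem : ∀ x, x ∈ X ↔ G.Adj i x := fun x => by simp [hX]
  have hYmem : ∀ x, x ∈ Y ↔ G.Adj j x := fun x => by simp [hY]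
  have hXY : ∀ x ∈ X, ∀ y ∈ Y, ¬ G.Adj x y := by
    intro x hx y hy hxy
    rw [hXmem] at hx
    rw [hYmem] at hy
    have h1 : i ≠ y := fun h => hnij (h ▸ hy.symm)
    have h2 : j ≠ x := fun h => hnij (h ▸ hx)
    obtain ⟨p, hp, hl, hav⟩ := hpath s {x, y} (by simp [hx.ne, h1]) (by simp [h2, hy.ne])
      (by have := Finset.card_le_two (a := x) (b := y); omega)
    obtain ⟨c, hc, hcl⟩ := hp.exists_isCycle_of_adj (hav x (by simp)) (hav y (by simp))
      hx.symm hy hxy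
    exact hC _ ⟨c, hc, by omega⟩
  have hUI := Finset.card_union_add_card_inter X Y
  have hU : (X ∪ Y).card < Fintype.card α := by
    by_contra! h
    exact hfree (hT.exists_embedding_of_complete_pair (compl_adj_of_forall_not_adj hXY) t h
      (by omega) (by omega) hij.2)
  set A := X ∩ Y with hA
  have hAX : A ⊆ X := Finset.inter_subset_left
  have hAY : A ⊆ Y := Finset.inter_subset_right
  have hAA : ∀ x ∈ A, ∀ y ∈ A, ¬ G.Adj x y := fun x hx y hy => hXY x (hAX hx) y (hAY hy)
  have hAn : A.card < Fintype.card α :=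
    (Finset.card_le_card (hAX.trans Finset.subset_union_left)).trans_lt hU
  set D := Finset.univ.filter fun v => ∀ a ∈ A, ¬ G.Adj a v with hD
  have hAD : A ⊆ D := fun x hx => by simpa [hD] using fun a ha => hAA a ha x hx
  have hDn : D.card < Fintype.card α := by
    by_contra! h
    refine hfree (hT.exists_embedding_of_complete_pair (X := A) (Y := D)
      (compl_adj_of_forall_not_adj fun a ha v hv => (Finset.mem_filter.1 hv).2 a ha) (2 * t)
      ?_ (by omega) (by omega) ?_)
    · rwa [Finset.union_eq_right.2 hAD]
    · rw [Finset.inter_eq_left.2 hAD]; omega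
  have hDc := Finset.card_add_card_compl D
  set B := Finset.univ.filter fun v => 1 < (A.filter (G.Adj v)).card with hB
  have hBD : B ⊆ Dᶜ := by
    intro v hv
    obtain ⟨a, ha⟩ := Finset.card_pos.1 (zero_lt_one.trans (Finset.mem_filter.1 hv).2)
    rw [Finset.mem_filter] at ha
    exact Finset.mem_compl.2 fun h => (Finset.mem_filter.1 h).2 a ha.1 ha.2.symm
  have hinner : ∀ a ∈ A, ∀ b ∈ A, a ≠ b → ∀ x y, x ∉ A → y ∉ A → x ≠ i → x ≠ j → y ≠ i → y ≠ j →
      ∃ p : G.Walk a b, p.IsPath ∧ p.length = 2 * s + 2 ∧ x ∉ p.support ∧ y ∉ p.support := by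
    intro a ha b hb hab x y hx hy hxi hxj hyi hyj
    have hia := (hXmem a).1 (hAX ha)
    have hib := (hXmem b).1 (hAX hb)
    have hja := (hYmem a).1 (hAY ha)
    have hjb := (hYmem b).1 (hAY hb)
    have hxa : x ≠ a := fun h => hx (h ▸ ha)
    have hxb : x ≠ b := fun h => hx (h ▸ hb)
    have hya : y ≠ a := fun h => hy (h ▸ ha)
    have hyb : y ≠ b := fun h => hy (h ▸ hb)
    rcases s with _ | s
    · refine ⟨.cons hia.symm (.cons hib .nil), ?_, by simp, ?_, ?_⟩
      · simp [Walk.cons_isPath_iff, hia.ne', hib.ne, hab]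
      · simp [hxa, hxb, hxi]
      · simp [hya, hyb, hyi]
    · obtain ⟨p, hp, hl, hav⟩ := hpath s {x, y, a, b}
        (by simp [hxi.symm, hyi.symm, hia.ne, hib.ne])
        (by simp [hxj.symm, hyj.symm, hja.ne, hjb.ne])
        (by have := Finset.card_le_four (a := x) (b := y) (c := a) (d := b); omega)
      have hpx := hav x (by simp)
      have hpy := hav y (by simp)
      have hpa := hav a (by simp)
      have hpb := hav b (by simp)
      refine ⟨.cons hia.symm (p.concat hjb), ?_, by simp [hl], ?_, ?_⟩
      · rw [Walk.cons_isPath_iff]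
        exact ⟨hp.concat hpb hjb, by simp [Walk.support_concat, hpa, hab]⟩
      · simp [Walk.support_concat, hpx, hxa, hxb]
      · simp [Walk.support_concat, hpy, hya, hyb]
  have hBW : ∀ x ∈ B, ∀ y ∈ Dᶜ, ¬ G.Adj x y := by
    intro x hx y hy hxy
    obtain ⟨b, hb, hyb⟩ : ∃ b ∈ A, G.Adj b y := by simpa [hD] using hy
    obtain ⟨a, ha, hab⟩ := Finset.exists_mem_ne (Finset.mem_filter.1 hx).2 b
    rw [Finset.mem_filter] at ha
    obtain ⟨ha, hxa⟩ := ha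
    have hxi : x ≠ i := fun h => hXY y ((hXmem y).2 (h ▸ hxy)) b (hAY hb) hyb.symm
    have hxj : x ≠ j := fun h => hXY b (hAX hb) y ((hYmem y).2 (h ▸ hxy)) hyb
    have hyi : y ≠ i := fun h => hXY x ((hXmem x).2 (h ▸ hxy.symm)) a (hAY ha) hxa
    have hyj : y ≠ j := fun h => hXY a (hAX ha) x ((hYmem x).2 (h ▸ hxy.symm)) hxa.symm
    obtain ⟨p, hp, hl, hpx, hpy⟩ := hinner a ha b hb hab x y (fun h => hAA x h a ha hxa)
      (fun h => hAA b hb y h hyb) hxi hxj hyi hyj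
    obtain ⟨c, hc, hcl⟩ := hp.exists_isCycle_of_adj hpx hpy hxa hyb hxy
    exact hC _ ⟨c, hc, by omega⟩
  have hBn : B.card + Fintype.card α / 2 < Fintype.card α := by
    by_contra! h
    refine hfree (hT.exists_embedding_of_complete_pair (compl_adj_of_forall_not_adj hBW)
      (Fintype.card α / 2) ?_ h (by omega) ?_)
    · rw [Finset.union_eq_right.2 hBD]; omega
    · rw [Finset.inter_eq_left.2 hBD]
      have := Finset.card_le_card hBD
      omega
  have hABc := Finset.card_add_card_compl (A ∪ B)
  have hABu := Finset.card_union_le A B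
  refine hfree (hT.exists_embedding_compl_of_few_neighbors G (t := t) (A := A) (C := (A ∪ B)ᶜ)
    (by omega) ?_ hAA (by omega) (by omega) fun c hc => ?_)
  · exact Finset.disjoint_of_subset_left Finset.subset_union_left disjoint_compl_right
  · rw [Finset.mem_compl, Finset.mem_union, not_or] at hc
    simpa [hB] using hc.2

theorem IsTree.exists_isCycle_or_exists_embedding_compl [Fintype α] [Fintype V]
    {T : SimpleGraph α} (hT : T.IsTree) (G : SimpleGraph V)
    (hV : Fintype.card V + 1 = 2 * Fintype.card α) {m : ℕ} (hm : 3 ≤ m) (hodd : Odd m)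
    (hmn : 50 * m ≤ Fintype.card α) :
    (∃ (u : V) (c : G.Walk u u), c.IsCycle ∧ c.length = m) ∨
      ∃ f : T →g Gᶜ, Function.Injective f := by
  classical
  refine or_iff_not_imp_right.2 fun hfree => ?_
  rcases hm.eq_or_lt with rfl | hm
  · obtain ⟨v, -, hv⟩ := hT.exists_mem_card_le_degree G hfree (S := Finset.univ)
      (by rw [Finset.card_univ]; omega)
    rw [Finset.card_univ, ← card_neighborFinset_eq_degree] at hv
    by_contra hC
    refine hfree (hT.exists_embedding_of_complete_pair (X := G.neighborFinset v)
      (Y := G.neighborFinset v) (compl_adj_of_forall_not_adj fun x hx y hy hxy => hC ?_) 0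
      ?_ ?_ ?_ (by simp))
    · rw [mem_neighborFinset] at hx hy
      obtain ⟨c, hc, hl⟩ := (Walk.IsPath.nil (G := G) (u := v)).exists_isCycle_of_adj
        (x := x) (y := y) (by simp [hx.ne']) (by simp [hy.ne']) hx.symm hy hxy
      exact ⟨_, c, hc, by simpa using hl⟩
    · rw [Finset.union_self]; omega
    · omega
    · omega
  · obtain ⟨s, rfl⟩ : ∃ s, m = 2 * s + 5 := by
      obtain ⟨k, rfl⟩ := hodd
      exact ⟨k - 2, by omega⟩
    set t := 5 * (2 * s + 5) with ht
    set H := Finset.univ.filter fun v => Fintype.card α + 1 ≤ G.degree v + t with hH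
    have hHdeg : ∀ v ∈ H, Fintype.card α + 1 ≤ G.degree v + t :=
      fun v hv => (Finset.mem_filter.1 hv).2
    obtain ⟨K, hKH, ⟨i, hi⟩, hK⟩ := exists_subset_forall_common (R := G.ManyCommon t)
      (fun _ _ h => h.symm) (m := 2 * s + 5) (by omega)
      (hT.card_filter_degree_ge G hfree hV (t := t) (by omega))
      (fun i hi j hj l hl hij hil hjl => manyCommon_of_degree hV (by omega) hij hil hjl
        (hHdeg i hi) (hHdeg j hj) (hHdeg l hl))
    obtain ⟨L, hLK, hLcard, hL⟩ := hK i hi i hi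
    obtain ⟨j, hj⟩ := Finset.card_pos.1 (show 0 < L.card by omega)
    exact hT.exists_isCycle_of_pair G hfree hV (t := t) (by omega) (hL j hj).1
      (hHdeg i (hKH hi)) (hHdeg j (hKH (hLK hj)))
      fun r X hiX hjX hX => ManyCommon.exists_path (d := 2 * s + 5 + 2) (by omega) hK r i hi j
        (hLK hj) (hL j hj).1 X hiX hjX hX

/-- The complete bipartite graph with sides of size `n - 1` contains no odd cycle, and its
complement contains no connected graph on `n` vertices. -/
theorem Connected.exists_bipartite_compl_free [Fintype α] {T : SimpleGraph α} (hT : T.Connected)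
    {m : ℕ} (hodd : Odd m) :
    ∃ G : SimpleGraph (Fin (2 * Fintype.card α - 2)),
      (¬ ∃ (u : Fin (2 * Fintype.card α - 2)) (p : G.Walk u u), p.IsCycle ∧ p.length = m) ∧
      ¬ ∃ f : T →g Gᶜ, Function.Injective f := by
  classical
  set n := Fintype.card α with hn
  let side : Fin (2 * n - 2) → Bool := fun v => decide (v.val < n - 1)
  let G : SimpleGraph (Fin (2 * n - 2)) := (⊤ : SimpleGraph Bool).comap side
  refine ⟨G, ?_, ?_⟩
  · rintro ⟨u, p, -, rfl⟩
    let c : G.Coloring Bool := Coloring.mk side fun h => h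
    have := (c.odd_length_iff_not_congr p).1 hodd
    tauto
  · rintro ⟨f, hf⟩
    have hside : ∀ u v, T.Reachable u v → side (f u) = side (f v) := by
      rintro u v ⟨p⟩
      induction p with
      | nil => rfl
      | cons h _ ih =>
        rw [← ih]
        have := ((compl_adj _ _ _).1 (f.map_adj h)).2
        simpa [G] using this
    obtain ⟨r⟩ := hT.nonempty
    let g : α → ℕ := fun v => if side (f r) then (f v).val else (f v).val - (n - 1)
    have hpos : 0 < n := Fintype.card_pos_iff.2 ⟨r⟩
    have hlt : ∀ v, g v < n - 1 := by
      intro v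
      have h1 := hside r v (hT.preconnected r v)
      have h2 := (f v).isLt
      simp only [g, h1, side, decide_eq_true_eq]
      split_ifs <;> omega
    have hinj : Function.Injective g := by
      intro u v huv
      have h1 := hside r u (hT.preconnected r u)
      have h2 := hside r v (hT.preconnected r v)
      refine hf (Fin.ext ?_)
      simp only [g] at huv
      split_ifs at huv with h
      · exact huv
      · rw [h1] at h
        have h3 : side (f v) ≠ true := by rw [← h2, h1]; exact h
        simp only [side, ne_eq, decide_eq_true_eq, not_lt] at h h3
        omega
    have := Finset.card_le_card_of_injOn g (s := Finset.univ) (t := Finset.range (n - 1))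
      (fun v _ => by simpa using hlt v) hinj.injOn
    rw [Finset.card_univ, Finset.card_range] at this
    omega

end SimpleGraph

/-- `R(T_n, C_m) = 2n - 1` for every tree `T_n` on `n` vertices and every odd `m ≥ 3`
with `n ≥ 50 m`: every graph on `2n - 1` vertices contains a cycle of length `m` or its
complement contains `T_n`, and there is a graph on `2n - 2` vertices for which neither
holds. -/
theorem stmt_13 {α : Type*} [Fintype α] (n m : ℕ) (hm : 3 ≤ m) (hodd : Odd m)
    (hnm : 50 * m ≤ n) (T : SimpleGraph α) (hT : T.IsTree) (hn : Fintype.card α = n) :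
    (∀ G : SimpleGraph (Fin (2 * n - 1)),
      (∃ (u : Fin (2 * n - 1)) (p : G.Walk u u), p.IsCycle ∧ p.length = m) ∨
      ∃ f : T →g Gᶜ, Function.Injective f) ∧
    (∃ G : SimpleGraph (Fin (2 * n - 2)),
      (¬ ∃ (u : Fin (2 * n - 2)) (p : G.Walk u u), p.IsCycle ∧ p.length = m) ∧
      ¬ ∃ f : T →g Gᶜ, Function.Injective f) := by
  subst hn
  exact ⟨fun G => hT.exists_isCycle_or_exists_embedding_compl G
    (by rw [Fintype.card_fin]; omega) hm hodd hnm, hT.connected.exists_bipartite_compl_free hodd⟩
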